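/- arXiv:1211.0608 — 2 statements merged into one kernel-verified Lean document; each statement's English description precedes it below -/
import Mathlib

section
/- For every scatterer configuration ξ, the map τ : C_N → C_N is injective: if τ(x) = τ(x') for x, x' ∈ C_N, then x = x'. -/
open MeasureTheory ProbabilityTheory

instance (R : ℕ) : Nonempty (ZMod R) := ⟨0⟩

/-- `J(k,i) = ξ(k,i)(1-ξ(k,i-1))(1-ξ(k,i+1))`. -/
def Jmap {R : ℕ} (ξ : ZMod R → ℤ → ℕ) (k : ZMod R) (i : ℤ) : ℕ :=
  ξ k i * (1 - ξ k (i - 1)) * (1 - ξ k (i + 1))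

/-- The one-step dynamics `τ` : move one step ahead on the ring (first coordinate,
mod `R`), jumping to the neighbouring ring when exactly one scatterer is present. -/
def tau {R : ℕ} (ξ : ZMod R → ℤ → ℕ) (p : ZMod R × ℤ) : ZMod R × ℤ :=
  if Jmap ξ p.1 p.2 = 1 then (p.1 + 1, p.2 + 1)
  else if Jmap ξ p.1 (p.2 - 1) = 1 then (p.1 + 1, p.2 - 1)
  else (p.1 + 1, p.2)

/-- A scatterer configuration: `{0,1}`-valued, vanishing outside `-N ≤ i ≤ N-1`. -/
def IsScatterer (N R : ℕ) (ξ : ZMod R → ℤ → ℕ) : Prop :=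
  (∀ (k : ZMod R) (i : ℤ), ξ k i ≤ 1) ∧
  (∀ (k : ZMod R) (i : ℤ), (i < -(N : ℤ) ∨ (N : ℤ) ≤ i) → ξ k i = 0)

/-- The phase space `C_N = (ℤ/Rℤ) × {i : |i| ≤ N}` viewed inside `(ℤ/Rℤ) × ℤ`. -/
def phase (N R : ℕ) : Set (ZMod R × ℤ) := {p | |p.2| ≤ (N : ℤ)}

/-- `τ^{-t}`, the `t`-th iterate of the inverse map `τ⁻¹`. -/
noncomputable def tauInvIter {R : ℕ} (ξ : ZMod R → ℤ → ℕ) (t : ℕ) :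
    ZMod R × ℤ → ZMod R × ℤ :=
  (Function.invFun (tau ξ))^[t]

/-- Two vertically adjacent sites cannot both be isolated scatterers. -/
theorem Jmap_add_one_ne_one {R : ℕ} (ξ : ZMod R → ℤ → ℕ) {k : ZMod R} {i : ℤ}
    (h : Jmap ξ k i = 1) : Jmap ξ k (i + 1) ≠ 1 := by
  intro h'
  simp only [Jmap, mul_eq_one] at h h'
  omega

/-- For every scatterer configuration, `τ` is injective on `C_N`. -/
theorem stmt1 (N R : ℕ) (hN : 1 ≤ N) (hR : 2 ≤ R)
    (ξ : ZMod R → ℤ → ℕ) (hξ : IsScatterer N R ξ) :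
    Set.InjOn (tau ξ) (phase N R) := by
  rintro ⟨k, i⟩ - ⟨k', i'⟩ - h
  have hk : k = k' := by
    have h₁ := congrArg Prod.fst h
    simp only [tau] at h₁
    split_ifs at h₁ <;> exact add_right_cancel h₁
  subst hk
  have hJ (j : ℤ) (hj : Jmap ξ k (j - 1) = 1) : Jmap ξ k j ≠ 1 := by
    simpa using Jmap_add_one_ne_one ξ hj
  have h₂ := congrArg Prod.snd h
  simp only [tau] at h₂
  have hi : i = i' := by
    split_ifs at h₂ <;> grind
  rw [hi]
end

section
/- For every scatterer configuration ξ, the map τ : C_N → C_N is a bijection of the finite phase space C_N onto itself; in particular τ is invertible. -/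
open MeasureTheory ProbabilityTheory

theorem Jmap_eq_one_iff {R : ℕ} (ξ : ZMod R → ℤ → ℕ) (k : ZMod R) (i : ℤ) :
    Jmap ξ k i = 1 ↔ ξ k i = 1 ∧ ξ k (i - 1) = 0 ∧ ξ k (i + 1) = 0 := by
  simp only [Jmap, mul_eq_one]
  omega

theorem IsScatterer.bounds_of_Jmap_eq_one {N R : ℕ} {ξ : ZMod R → ℤ → ℕ}
    (hξ : IsScatterer N R ξ) {k : ZMod R} {i : ℤ} (h : Jmap ξ k i = 1) :
    -(N : ℤ) ≤ i ∧ i < N := by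
  have h₁ := ((Jmap_eq_one_iff ξ k i).1 h).1
  by_contra hi
  have h₀ := hξ.2 k i (by omega)
  omega

/-- The action of `tau` on the second coordinate. -/
def verticalMove {R : ℕ} (ξ : ZMod R → ℤ → ℕ) (k : ZMod R) (i : ℤ) : ℤ :=
  if Jmap ξ k i = 1 then i + 1 else if Jmap ξ k (i - 1) = 1 then i - 1 else i

theorem tau_eq {R : ℕ} (ξ : ZMod R → ℤ → ℕ) (p : ZMod R × ℤ) :
    tau ξ p = (p.1 + 1, verticalMove ξ p.1 p.2) := by
  unfold tau verticalMove
  split_ifs <;> rfl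

theorem verticalMove_involutive {R : ℕ} (ξ : ZMod R → ℤ → ℕ) (k : ZMod R) :
    Function.Involutive (verticalMove ξ k) := by
  intro i
  have disjoint (j : ℤ) (h : Jmap ξ k j = 1) : Jmap ξ k (j + 1) ≠ 1 := by
    rw [Jmap_eq_one_iff] at h
    rw [ne_eq, Jmap_eq_one_iff]
    omega
  by_cases h : Jmap ξ k i = 1
  · simp [verticalMove, h, disjoint i h]
  · by_cases h' : Jmap ξ k (i - 1) = 1 <;> simp [verticalMove, h, h']

theorem IsScatterer.abs_verticalMove_le {N R : ℕ} {ξ : ZMod R → ℤ → ℕ}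
    (hξ : IsScatterer N R ξ) (k : ZMod R) {i : ℤ} (hi : |i| ≤ (N : ℤ)) :
    |verticalMove ξ k i| ≤ (N : ℤ) := by
  rw [abs_le] at hi ⊢
  unfold verticalMove
  split_ifs with h h'
  · have := hξ.bounds_of_Jmap_eq_one h
    omega
  · have := hξ.bounds_of_Jmap_eq_one h'
    omega
  · exact hi

/-- For every scatterer configuration, `τ` is a bijection of the finite phase
space `C_N` onto itself. -/
theorem stmt2 (N R : ℕ) (hN : 1 ≤ N) (hR : 2 ≤ R)
    (ξ : ZMod R → ℤ → ℕ) (hξ : IsScatterer N R ξ) :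
    Set.BijOn (tau ξ) (phase N R) (phase N R) := by
  refine ⟨fun p hp => ?_, fun p _ q _ hpq => ?_, fun p hp => ?_⟩
  · rw [tau_eq]
    exact hξ.abs_verticalMove_le p.1 hp
  · rw [tau_eq, tau_eq, Prod.mk.injEq, add_left_inj] at hpq
    obtain ⟨hk, hi⟩ := hpq
    rw [hk] at hi
    exact Prod.ext hk ((verticalMove_involutive ξ q.1).injective hi)
  · refine ⟨(p.1 - 1, verticalMove ξ (p.1 - 1) p.2), hξ.abs_verticalMove_le _ hp, ?_⟩
    rw [tau_eq]
    exact Prod.ext (sub_add_cancel _ _) (verticalMove_involutive ξ _ p.2)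
end
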